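/- arXiv:1608.02022 — 2 statements merged into one kernel-verified Lean document; each statement's English description precedes it below -/
import Mathlib

section
/- Every nonnegative integer n can be written as n = p₅(x₁) + p₅(x₂) + 2·p₅(x₃) + 2·p₅(x₄) with x₁, x₂, x₃, x₄ nonnegative integers. -/
/-- `n` is a sum of three integer squares. -/
def SumThreeSq (n : ℤ) : Prop := ∃ p q r : ℤ, n = p ^ 2 + q ^ 2 + r ^ 2

lemma exists_shift (B A : ℤ) (hA : 0 < A) : ∃ k : ℤ, 2 * (B + k * A) ≤ A ∧ -A ≤ 2 * (B + k * A) := by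
  refine ⟨-((2 * B + A) / (2 * A)), ?_⟩
  have h1 := Int.emod_add_mul_ediv (2 * B + A) (2 * A)
  have h2 := Int.emod_nonneg (2 * B + A) (show 2 * A ≠ 0 by omega)
  have h3 := Int.emod_lt_of_pos (2 * B + A) (show 0 < 2 * A by omega)
  constructor <;> nlinarith

/-- A positive definite integral ternary form of determinant one only represents sums of three
squares. -/
lemma ternary_det_one (N : ℕ) : ∀ (M : ℕ) (a b c d e g : ℤ), a.toNat = N →
    (a * b - g ^ 2).toNat = M → 0 < a → 0 < a * b - g ^ 2 →
    a * b * c + 2 * d * e * g - a * d ^ 2 - b * e ^ 2 - c * g ^ 2 = 1 →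
    ∀ x y z : ℤ, SumThreeSq
      (a * x ^ 2 + b * y ^ 2 + c * z ^ 2 + 2 * d * y * z + 2 * e * x * z + 2 * g * x * y) := by
  induction N using Nat.strong_induction_on with
  | _ N ihN =>
  intro M
  induction M using Nat.strong_induction_on with
  | _ M ihM =>
  -- the reduced case
  have key : ∀ (a b c d e g : ℤ), a.toNat = N →
    (a * b - g ^ 2).toNat = M → 0 < a → 0 < a * b - g ^ 2 →
    a * b * c + 2 * d * e * g - a * d ^ 2 - b * e ^ 2 - c * g ^ 2 = 1 →
    2 * g ≤ a → -a ≤ 2 * g →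
    2 * (a * d - g * e) ≤ a * b - g ^ 2 → -(a * b - g ^ 2) ≤ 2 * (a * d - g * e) →
    ∀ x y z : ℤ, SumThreeSq
      (a * x ^ 2 + b * y ^ 2 + c * z ^ 2 + 2 * d * y * z + 2 * e * x * z + 2 * g * x * y) := by
    intro a b c d e g hN hM ha hA hdet hg1 hg2 hB1 hB2 x y z
    have hdisc : (a * b - g ^ 2) * (a * c - e ^ 2) = a + (a * d - g * e) ^ 2 := by
      linear_combination a * hdet
    have hC : 0 < a * c - e ^ 2 := by
      have : 0 < (a * b - g ^ 2) * (a * c - e ^ 2) := by rw [hdisc]; positivity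
      exact pos_of_mul_pos_right this hA.le
    by_cases hCA : a * c - e ^ 2 < a * b - g ^ 2
    · have := ihM (a * c - e ^ 2).toNat (by omega) a c b d g e hN rfl ha hC
        (by linear_combination hdet) x z y
      convert this using 1
      ring
    have hb : 0 < b := by
      have : 0 < a * b := by nlinarith [sq_nonneg g]
      exact pos_of_mul_pos_right this ha.le
    by_cases hba : b < a
    · have := ihN b.toNat (by omega) _ b a c e d g rfl rfl hb (by linarith)
        (by linear_combination hdet) y x z
      convert this using 1
      ring
    push Not at hCA hba
    have hBsq : 4 * (a * d - g * e) ^ 2 ≤ (a * b - g ^ 2) ^ 2 := by nlinarith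
    have hgsq : 4 * g ^ 2 ≤ a ^ 2 := by nlinarith
    have hA2 : 3 * (a * b - g ^ 2) ^ 2 ≤ 4 * a := by nlinarith
    have ha2 : 3 * a ^ 2 ≤ 4 * (a * b - g ^ 2) := by nlinarith
    have ha1 : a = 1 := by
      by_contra hne
      have h2 : 2 ≤ a := by omega
      generalize a * b - g ^ 2 = A at *
      have h3 : 3 * a ≤ 2 * A := by nlinarith
      nlinarith
    subst ha1
    have hg0 : g = 0 := by omega
    subst hg0
    have hb1 : b = 1 := by nlinarith
    subst hb1
    have hd0 : d = 0 := by omega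
    subst hd0
    exact ⟨x + e * z, y, z, by linear_combination z ^ 2 * hdet⟩
  intro a b c d e g hN hM ha hA hdet x y z
  obtain ⟨k, hk1, hk2⟩ := exists_shift (a * d - g * e) (a * b - g ^ 2) hA
  obtain ⟨l, hl1, hl2⟩ := exists_shift g a ha
  -- first y ↦ y + k z, then x ↦ x + l y
  have e1 : a * (b + 2 * l * g + l ^ 2 * a) - (g + l * a) ^ 2 = a * b - g ^ 2 := by ring
  have e2 : a * ((d + k * b) + l * (e + k * g)) - (g + l * a) * (e + k * g)
      = a * d - g * e + k * (a * b - g ^ 2) := by ring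
  have := key a (b + 2 * l * g + l ^ 2 * a) (c + 2 * k * d + k ^ 2 * b)
    ((d + k * b) + l * (e + k * g)) (e + k * g) (g + l * a) hN (by rw [e1]; exact hM) ha
    (by rw [e1]; exact hA) (by linear_combination hdet) hl1 hl2 (by rw [e1, e2]; exact hk1)
    (by rw [e1, e2]; exact hk2) (x - l * (y - k * z)) (y - k * z) z
  convert this using 1
  ring

open NumberTheorySymbols in
lemma jacobi_aux (p d n : ℕ) (hp : p % 2 = 1) (hd : d % 8 = 3) (h : 2 * p + 1 = d * n) :
    J(-(d : ℤ) | p) = 1 := by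
  have hpo : Odd p := Nat.odd_iff.mpr hp
  have hdo : Odd d := Nat.odd_iff.mpr (by omega)
  have h2 : J(-2 | d) = 1 := by
    rw [jacobiSym.at_neg_two hdo, ZMod.χ₈'_nat_eq_if_mod_eight]
    simp [hd, show d % 2 = 1 by omega]
  have h3 : J(-2 | d) * J((p : ℤ) | d) = 1 := by
    rw [← jacobiSym.mul_left, ← jacobiSym.one_left d]
    apply jacobiSym.mod_left'
    apply Int.ModEq.symm
    apply (Int.modEq_iff_dvd).mpr
    refine ⟨-n, ?_⟩
    have : (2 * p + 1 : ℤ) = d * n := by exact_mod_cast h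
    linear_combination -this
  have h4 : J((p : ℤ) | d) = 1 := by rw [h2] at h3; linarith
  rw [jacobiSym.neg _ hpo]
  rcases (show p % 4 = 1 ∨ p % 4 = 3 by omega) with h' | h'
  · rw [ZMod.χ₄_nat_one_mod_four h', ← jacobiSym.quadratic_reciprocity_one_mod_four h' hdo, h4]
    norm_num
  · rw [ZMod.χ₄_nat_three_mod_four h',
      jacobiSym.quadratic_reciprocity_three_mod_four (by omega) h', h4]
    norm_num

/-- Natural numbers congruent to one mod four are sums of three squares. -/
lemma sumThreeSq_of_one_mod_four (n : ℕ) (hn : n % 4 = 1) : SumThreeSq n := by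
  obtain ⟨m, hm⟩ : ∃ m, n = 4 * m + 1 := ⟨n / 4, by omega⟩
  have hcop : Nat.Coprime (6 * m + 1) (4 * n) := by
    rw [Nat.coprime_iff_gcd_eq_one, ← Int.gcd_natCast_natCast, ← Int.isCoprime_iff_gcd_eq_one]
    rw [show ((4 * n : ℕ) : ℤ) = 2 * (2 * n) by push_cast; ring]
    have c2 : IsCoprime ((6 * m + 1 : ℕ) : ℤ) 2 := ⟨1, -(3 * m), by push_cast; ring⟩
    have cn : IsCoprime ((6 * m + 1 : ℕ) : ℤ) n := ⟨-2, 3, by rw [hm]; push_cast; ring⟩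
    exact c2.mul_right (c2.mul_right cn)
  obtain ⟨p, hpgt, hpp, hpm⟩ :=
    Nat.forall_exists_prime_gt_and_modEq (6 * m + 1) (q := 4 * n) (by omega) hcop
  obtain ⟨j, hj⟩ := (Nat.modEq_iff_dvd' hpgt.le).mp hpm.symm
  have hp' : p = 4 * n * j + (6 * m + 1) := by omega
  have hdn : 2 * p + 1 = (8 * j + 3) * n := by rw [hp', hm]; ring
  have hpodd : p % 2 = 1 := by
    rw [hp', show 4 * n * j + (6 * m + 1) = 2 * (2 * n * j + 3 * m) + 1 by ring]; omega
  have hJ := jacobi_aux p (8 * j + 3) n hpodd (by omega) hdn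
  have : Fact p.Prime := ⟨hpp⟩
  have hsq := ZMod.isSquare_of_jacobiSym_eq_one hJ
  obtain ⟨t₀, ht₀⟩ := hsq
  obtain ⟨t, rfl⟩ := ZMod.intCast_surjective t₀
  have hdvd : (p : ℤ) ∣ t ^ 2 + (8 * j + 3 : ℕ) := by
    rw [← ZMod.intCast_zmod_eq_zero_iff_dvd]
    push_cast at ht₀ ⊢
    linear_combination -ht₀
  have hex : ∃ s : ℤ, (p : ℤ) ∣ s ^ 2 + (8 * j + 3 : ℕ) ∧ s % 2 = 1 := by
    rcases Int.emod_two_eq_zero_or_one t with h | h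
    · refine ⟨t + p, ?_, by omega⟩
      rw [show (t + p) ^ 2 + ((8 * j + 3 : ℕ) : ℤ) = t ^ 2 + (8 * j + 3 : ℕ) + p * (2 * t + p) by ring]
      exact dvd_add hdvd (dvd_mul_right _ _)
    · exact ⟨t, hdvd, h⟩
  obtain ⟨s, hs, hs2⟩ := hex
  have h2 : (2 : ℤ) ∣ s ^ 2 + (8 * j + 3 : ℕ) := by
    obtain ⟨r, hr⟩ : ∃ r, s = 2 * r + 1 := ⟨s / 2, by omega⟩
    exact ⟨2 * r ^ 2 + 2 * r + 4 * j + 2, by rw [hr]; push_cast; ring⟩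
  have hc : IsCoprime (2 : ℤ) p := ⟨-((p / 2 : ℕ) : ℤ), 1, by omega⟩
  obtain ⟨a, ha⟩ := hc.mul_dvd h2 hs
  push_cast at ha
  have hpp0 : (0 : ℤ) < p := by exact_mod_cast hpp.pos
  have ha0 : 0 < a := by
    have : (0 : ℤ) < 2 * p * a := by rw [← ha]; positivity
    exact pos_of_mul_pos_right this (by positivity)
  have hdnZ : (2 * p + 1 : ℤ) = (8 * j + 3) * n := by exact_mod_cast hdn
  have := ternary_det_one _ _ a (2 * p) n 0 1 s rfl rfl ha0 (by nlinarith)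
    (by linear_combination -(n : ℤ) * ha - hdnZ) 0 0 1
  simpa using this

lemma form236_aux (p q r : ℤ) (h3 : (p + q + r) % 3 = 0) (h2 : (q - r) % 2 = 0) :
    ∃ w u v : ℤ, p ^ 2 + q ^ 2 + r ^ 2 = 2 * w ^ 2 + 3 * u ^ 2 + 6 * v ^ 2 := by
  obtain ⟨y, hy⟩ : ∃ y, p + q + r = 3 * y := ⟨(p + q + r) / 3, by omega⟩
  obtain ⟨x, hx⟩ : ∃ x, q = r + 2 * x := ⟨(q - r) / 2, by omega⟩
  obtain ⟨z, hz⟩ : ∃ z, p = y + 2 * z := ⟨(p - y) / 2, by omega⟩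
  have hr : r = y - z - x := by omega
  refine ⟨x, y, z, ?_⟩
  subst hx hz
  rw [hr]; ring

lemma form236_aux2 (p q r : ℤ) (h3 : (p + q + r) % 3 = 0) :
    ∃ w u v : ℤ, p ^ 2 + q ^ 2 + r ^ 2 = 2 * w ^ 2 + 3 * u ^ 2 + 6 * v ^ 2 := by
  rcases (show (q - r) % 2 = 0 ∨ (p - r) % 2 = 0 ∨ (p - q) % 2 = 0 by omega) with h | h | h
  · exact form236_aux p q r h3 h
  · obtain ⟨w, u, v, H⟩ := form236_aux q p r (by omega) h
    exact ⟨w, u, v, by linarith⟩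
  · obtain ⟨w, u, v, H⟩ := form236_aux r p q (by omega) h
    exact ⟨w, u, v, by linarith⟩

lemma sq_mod_three (p : ℤ) : (p % 3 = 0 ∧ p ^ 2 % 3 = 0) ∨ (p % 3 = 1 ∧ p ^ 2 % 3 = 1) ∨
    (p % 3 = 2 ∧ p ^ 2 % 3 = 1) := by
  rcases (show p % 3 = 0 ∨ p % 3 = 1 ∨ p % 3 = 2 by omega) with h | h | h <;>
    simp [h, pow_two, Int.mul_emod]

lemma form236 (N : ℤ) (h : SumThreeSq N) (h3 : N % 3 ≠ 1) :
    ∃ w u v : ℤ, N = 2 * w ^ 2 + 3 * u ^ 2 + 6 * v ^ 2 := by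
  obtain ⟨p, q, r, rfl⟩ := h
  have hs : (p + q + r) % 3 = 0 ∨ (-p + q + r) % 3 = 0 ∨ (p + -q + r) % 3 = 0 ∨
      (p + q + -r) % 3 = 0 := by
    have := sq_mod_three p
    have := sq_mod_three q
    have := sq_mod_three r
    omega
  rcases hs with h | h | h | h <;> simpa using form236_aux2 _ _ _ h

lemma cauchy_1122 (a b : ℤ) (hb : b % 2 = 1) (ha : a % 2 = 1) (h0 : b ^ 2 ≤ 6 * a) :
    ∃ x₁ x₂ x₃ x₄ : ℤ, x₁ + x₂ + 2 * x₃ + 2 * x₄ = b ∧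
      x₁ ^ 2 + x₂ ^ 2 + 2 * x₃ ^ 2 + 2 * x₄ ^ 2 = a := by
  have hb4 : b ^ 2 % 4 = 1 := by
    rcases (show b % 4 = 1 ∨ b % 4 = 3 by omega) with h | h <;> simp [h, pow_two, Int.mul_emod]
  obtain ⟨m, hm⟩ : ∃ m : ℕ, (m : ℤ) = 6 * a - b ^ 2 := ⟨(6 * a - b ^ 2).toNat, by omega⟩
  have hS := sumThreeSq_of_one_mod_four m (by omega)
  rw [hm] at hS
  obtain ⟨w, u, v, H⟩ := form236 _ hS (by have := sq_mod_three b; omega)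
  have hw : ∃ w' : ℤ, w' ^ 2 = w ^ 2 ∧ (b - w') % 3 = 0 := by
    have h1 := sq_mod_three b
    have h2 := sq_mod_three w
    by_cases h : (b - w) % 3 = 0
    · exact ⟨w, rfl, h⟩
    · exact ⟨-w, by ring, by omega⟩
  obtain ⟨w', hw1, hw2⟩ := hw
  rw [← hw1] at H
  clear hw1
  obtain ⟨t, ht⟩ : ∃ t, w' = b - 3 * t := ⟨(b - w') / 3, by omega⟩
  have sq2 : ∀ z : ℤ, (z % 2 = 0 ∧ z ^ 2 % 4 = 0) ∨ (z % 2 = 1 ∧ z ^ 2 % 4 = 1) := by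
    intro z
    rcases (show z % 4 = 0 ∨ z % 4 = 1 ∨ z % 4 = 2 ∨ z % 4 = 3 by omega) with h | h | h | h <;>
      simp [h, pow_two, Int.mul_emod] <;> omega
  have hu := sq2 u
  have hv := sq2 v
  have hw := sq2 w'
  obtain ⟨x₃, hx₃⟩ : ∃ x, v = 2 * x - t := ⟨(v + t) / 2, by omega⟩
  obtain ⟨x₁, hx₁⟩ : ∃ x, u = 2 * x - (b - 2 * t) := ⟨(u + b - 2 * t) / 2, by omega⟩
  refine ⟨x₁, b - 2 * t - x₁, x₃, t - x₃, by ring, ?_⟩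
  clear hu hv hw sq2
  subst hx₃ hx₁ ht
  have : 6 * (x₁ ^ 2 + (b - 2 * t - x₁) ^ 2 + 2 * x₃ ^ 2 + 2 * (t - x₃) ^ 2) = 6 * a := by
    linear_combination -H
  linarith

lemma pent_cast (x : ℕ) : (2 * (x * (3 * x - 1) / 2 : ℕ) : ℤ) = 3 * (x : ℤ) ^ 2 - x := by
  have hev : 2 ∣ x * (3 * x - 1) := by
    rcases Nat.even_or_odd' x with ⟨k, rfl | rfl⟩
    · exact ⟨k * (3 * (2 * k) - 1), by ring⟩
    · exact ⟨(2 * k + 1) * (3 * k + 1), by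
        rw [show 3 * (2 * k + 1) - 1 = 2 * (3 * k + 1) by omega]; ring⟩
  have h : 2 * (x * (3 * x - 1) / 2) = x * (3 * x - 1) := Nat.mul_div_cancel' hev
  have h' : ((2 * (x * (3 * x - 1) / 2) : ℕ) : ℤ) = ((x * (3 * x - 1) : ℕ) : ℤ) := by rw [h]
  rw [Nat.cast_mul] at h'
  push_cast at h' ⊢
  rw [h']
  rcases Nat.eq_zero_or_pos x with rfl | hx
  · simp
  · rw [Nat.cast_sub (by omega)]; push_cast; ring

lemma bound1 (a b : ℤ) (hb0 : 50 ≤ b) (hkey : 5 * a < 5 + (b + 1) ^ 2) : ∀ x y z t : ℤ, x + y + 2 * z + 2 * t = b →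
      x ^ 2 + y ^ 2 + 2 * z ^ 2 + 2 * t ^ 2 = a → 0 ≤ x := by
  intro x y z t e1 e2
  by_contra hx
  push Not at hx
  have hc : (y + 2 * z + 2 * t) ^ 2 ≤ 5 * (y ^ 2 + 2 * z ^ 2 + 2 * t ^ 2) := by
    nlinarith [sq_nonneg (y - z), sq_nonneg (y - t), sq_nonneg (z - t)]
  have he : y + 2 * z + 2 * t = b - x := by linarith
  rw [he] at hc
  have hx2 : 1 ≤ x ^ 2 := by nlinarith
  have hbx : (b + 1) ^ 2 ≤ (b - x) ^ 2 := pow_le_pow_left₀ (by linarith) (by linarith) 2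
  linarith

lemma bound3 (a b : ℤ) (hb0 : 50 ≤ b) (hkey : 5 * a < 5 + (b + 1) ^ 2) : ∀ x y z t : ℤ, x + y + 2 * z + 2 * t = b →
      x ^ 2 + y ^ 2 + 2 * z ^ 2 + 2 * t ^ 2 = a → 0 ≤ z := by
  intro x y z t e1 e2
  by_contra hx
  push Not at hx
  have hc : (x + y + 2 * t) ^ 2 ≤ 4 * (x ^ 2 + y ^ 2 + 2 * t ^ 2) := by
    nlinarith [sq_nonneg (x - y), sq_nonneg (x - t), sq_nonneg (y - t)]
  have he : x + y + 2 * t = b - 2 * z := by linarith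
  rw [he] at hc
  have hx2 : 1 ≤ z ^ 2 := by nlinarith
  have hbx : (b + 1) ^ 2 ≤ (b - 2 * z) ^ 2 := pow_le_pow_left₀ (by linarith) (by linarith) 2
  have hb2 := sq_nonneg (b + 1)
  linarith

/-- The theorem for large `n`. -/
lemma large_case (n : ℕ) (hn : 729 ≤ n) :
    ∃ x₁ x₂ x₃ x₄ : ℕ,
      n = x₁ * (3 * x₁ - 1) / 2 + x₂ * (3 * x₂ - 1) / 2
          + 2 * (x₃ * (3 * x₃ - 1) / 2) + 2 * (x₄ * (3 * x₄ - 1) / 2) := by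
  obtain ⟨m, hm1, hm2⟩ : ∃ m : ℕ, m ^ 2 ≤ 4 * n + 1 ∧ 4 * n + 1 < (m + 1) ^ 2 :=
    ⟨Nat.sqrt (4 * n + 1), Nat.sqrt_le' _, Nat.lt_succ_sqrt' _⟩
  have hm : 54 ≤ m := by
    by_contra hlt
    have : m + 1 ≤ 54 := by omega
    have := Nat.pow_le_pow_left this 2
    omega
  obtain ⟨b, hb1, hb2, hb3, hb4⟩ : ∃ b : ℤ, (m : ℤ) - 4 ≤ b ∧ b ≤ m + 1 ∧ b % 2 = 1 ∧
      (2 * n + b) % 3 = 0 := by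
    have key : ∃ i : ℤ, 0 ≤ i ∧ i < 6 ∧ ((m : ℤ) + 1 - i) % 2 = 1 ∧
        (2 * n + (m + 1 - i)) % 3 = 0 := by
      refine ⟨((m : ℤ) + 1 - (3 + 4 * n)) % 6, by omega, by omega, by omega, by omega⟩
    obtain ⟨i, h1, h2, h3, h4⟩ := key
    exact ⟨m + 1 - i, by omega, by omega, h3, h4⟩
  obtain ⟨a, ha⟩ : ∃ a : ℤ, 2 * n + b = 3 * a := ⟨(2 * n + b) / 3, by omega⟩
  zify at hm1 hm2 hm
  have hb0 : 50 ≤ b := by linarith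
  have hup : b ^ 2 ≤ 6 * a := by nlinarith
  have hlow : 10 * (n : ℤ) < 3 * b ^ 2 + b + 18 := by nlinarith
  obtain ⟨x₁, x₂, x₃, x₄, h1, h2⟩ := cauchy_1122 a b hb3 (by omega) hup
  have hkey : 5 * a < 5 + (b + 1) ^ 2 := by nlinarith
  have p1 := bound1 a b hb0 hkey x₁ x₂ x₃ x₄ h1 h2
  have p2 := bound1 a b hb0 hkey x₂ x₁ x₃ x₄ (by linarith) (by linarith)
  have p3 := bound3 a b hb0 hkey x₁ x₂ x₃ x₄ h1 h2
  have p4 := bound3 a b hb0 hkey x₁ x₂ x₄ x₃ (by linarith) (by linarith)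
  lift x₁ to ℕ using p1
  lift x₂ to ℕ using p2
  lift x₃ to ℕ using p3
  lift x₄ to ℕ using p4
  refine ⟨x₁, x₂, x₃, x₄, ?_⟩
  have c1 := pent_cast x₁
  have c2 := pent_cast x₂
  have c3 := pent_cast x₃
  have c4 := pent_cast x₄
  zify
  push_cast at c1 c2 c3 c4 ⊢
  linarith

/-- Bit mask of the sumset of the set coded by `S` with `{f 0, …, f (k - 1)}`. -/
def maskStep (S : ℕ) (f : ℕ → ℕ) : ℕ → ℕ
  | 0 => 0
  | k + 1 => maskStep S f k ||| (S <<< f k)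

lemma maskStep_sound (S : ℕ) (f : ℕ → ℕ) (k n : ℕ) (h : (maskStep S f k).testBit n = true) :
    ∃ x m, n = m + f x ∧ S.testBit m = true := by
  induction k with
  | zero => simp [maskStep] at h
  | succ k ih =>
    rw [maskStep, Nat.testBit_or, Bool.or_eq_true] at h
    rcases h with h | h
    · exact ih h
    · rw [Nat.testBit_shiftLeft, Bool.and_eq_true, decide_eq_true_eq] at h
      exact ⟨k, n - f k, by omega, h.2⟩

/-- Bit mask of the numbers represented with small arguments. -/
def maskAll : ℕ :=
  maskStep (maskStep (maskStep (maskStep 1 (fun x => x * (3 * x - 1) / 2) 23)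
    (fun x => x * (3 * x - 1) / 2) 23) (fun x => 2 * (x * (3 * x - 1) / 2)) 16)
    (fun x => 2 * (x * (3 * x - 1) / 2)) 16

lemma maskAll_mod : maskAll % 2 ^ 729 = 2 ^ 729 - 1 := by
  decide +kernel

lemma testBit_of_mod (M K n : ℕ) (hM : M % 2 ^ K = 2 ^ K - 1) (hn : n < K) :
    M.testBit n = true := by
  have h1 : (M % 2 ^ K).testBit n = true := by
    rw [hM, Nat.testBit_two_pow_sub_one]
    simpa using hn
  rw [Nat.testBit_mod_two_pow, Bool.and_eq_true] at h1
  exact h1.2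

/-- The theorem for small `n`. -/
lemma small_case (n : ℕ) (hn : n < 729) :
    ∃ x₁ x₂ x₃ x₄ : ℕ,
      n = x₁ * (3 * x₁ - 1) / 2 + x₂ * (3 * x₂ - 1) / 2
          + 2 * (x₃ * (3 * x₃ - 1) / 2) + 2 * (x₄ * (3 * x₄ - 1) / 2) := by
  have h : maskAll.testBit n = true := testBit_of_mod _ _ _ maskAll_mod hn
  unfold maskAll at h
  obtain ⟨x₄, m₄, e₄, h⟩ := maskStep_sound _ _ _ _ h
  obtain ⟨x₃, m₃, e₃, h⟩ := maskStep_sound _ _ _ _ h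
  obtain ⟨x₂, m₂, e₂, h⟩ := maskStep_sound _ _ _ _ h
  obtain ⟨x₁, m₁, e₁, h⟩ := maskStep_sound _ _ _ _ h
  have h0 : m₁ = 0 := by simpa [Nat.testBit_one_eq_true_iff_self_eq_zero] using h
  refine ⟨x₁, x₂, x₃, x₄, ?_⟩
  subst h0 e₁ e₂ e₃ e₄
  ring

theorem sum_pentagonal_1122 (n : ℕ) :
    ∃ x₁ x₂ x₃ x₄ : ℕ,
      n = x₁ * (3 * x₁ - 1) / 2 + x₂ * (3 * x₂ - 1) / 2
          + 2 * (x₃ * (3 * x₃ - 1) / 2) + 2 * (x₄ * (3 * x₄ - 1) / 2) := by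
  rcases lt_or_ge n 729 with h | h
  · exact small_case n h
  · exact large_case n h
end

section
/- The set of all sums p₆(x₁) + p₆(x₂) + 2·p₆(x₃) + 2·p₆(x₄) with x₁, x₂, x₃, x₄ nonnegative integers equals the set of all nonnegative integers except 22, 82, 100. -/
/-- Reduction of positive definite binary forms. -/
theorem binary_reduce (N : ℕ) : ∀ p q r D : ℤ, p.toNat ≤ N → 0 < p → 0 < D → p * r - q ^ 2 = D →
    ∃ α β γ δ : ℤ, α * δ - β * γ = 1 ∧ 0 < α ^ 2 * p + 2 * α * γ * q + γ ^ 2 * r ∧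
      3 * (α ^ 2 * p + 2 * α * γ * q + γ ^ 2 * r) ^ 2 ≤ 4 * D := by
  induction N with
  | zero => intro p q r D h hp; omega
  | succ N ih =>
    intro p q r D hN hp hD h
    obtain ⟨k, hk1, hk2⟩ : ∃ k : ℤ, 2 * (q + k * p) ≤ p ∧ -p ≤ 2 * (q + k * p) := by
      refine ⟨-((2 * q + p) / (2 * p)), ?_, ?_⟩
      · have := Int.lt_ediv_add_one_mul_self (2 * q + p) (show 0 < 2 * p by omega)
        nlinarith
      · have := Int.ediv_mul_le (2 * q + p) (show 2 * p ≠ 0 by omega)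
        nlinarith
    have hD' : p * (r + 2 * k * q + k ^ 2 * p) - (q + k * p) ^ 2 = D := by rw [← h]; ring
    generalize hq : q + k * p = q' at *
    generalize hr : r + 2 * k * q + k ^ 2 * p = r' at *
    have hr0 : 0 < r' := by
      by_contra hcon
      nlinarith [sq_nonneg q']
    by_cases hlt : r' < p
    · obtain ⟨α, β, γ, δ, h1, h2, h3⟩ := ih r' (-q') p D (by omega) hr0 hD (by rw [← hD']; ring)
      have e : (k * α - γ) ^ 2 * p + 2 * (k * α - γ) * α * q + α ^ 2 * r
          = α ^ 2 * r' + 2 * α * γ * (-q') + γ ^ 2 * p := by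
        rw [← hq, ← hr]; ring
      refine ⟨k * α - γ, k * β - δ, α, β, ?_, ?_, ?_⟩
      · linear_combination h1
      · rw [e]; exact h2
      · rw [e]; exact h3
    · refine ⟨1, 0, 0, 1, by ring, by linarith, ?_⟩
      have : 4 * q' ^ 2 ≤ p ^ 2 := by nlinarith
      nlinarith

/-- The Gram matrix with entries `a b c / d e / f` comes from three vectors in `ℤ³`. -/
def IsGram (a b c d e f : ℤ) : Prop :=
  ∃ x1 x2 x3 y1 y2 y3 z1 z2 z3 : ℤ,
    x1 * x1 + x2 * x2 + x3 * x3 = a ∧ x1 * y1 + x2 * y2 + x3 * y3 = b ∧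
    x1 * z1 + x2 * z2 + x3 * z3 = c ∧ y1 * y1 + y2 * y2 + y3 * y3 = d ∧
    y1 * z1 + y2 * z2 + y3 * z3 = e ∧ z1 * z1 + z2 * z2 + z3 * z3 = f

theorem IsGram.swap {a b c d e f : ℤ} (h : IsGram d b e a c f) : IsGram a b c d e f := by
  obtain ⟨x1, x2, x3, y1, y2, y3, z1, z2, z3, h1, h2, h3, h4, h5, h6⟩ := h
  exact ⟨y1, y2, y3, x1, x2, x3, z1, z2, z3, h4, by linarith, h5, h1, h3, h6⟩

theorem IsGram.trans {a b c d e f : ℤ} (k l : ℤ)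
    (h : IsGram a (b + k * a) (c + l * a) (d + 2 * k * b + k ^ 2 * a)
      (e + k * c + l * b + k * l * a) (f + 2 * l * c + l ^ 2 * a)) : IsGram a b c d e f := by
  obtain ⟨x1, x2, x3, y1, y2, y3, z1, z2, z3, h1, h2, h3, h4, h5, h6⟩ := h
  refine ⟨x1, x2, x3, y1 - k * x1, y2 - k * x2, y3 - k * x3, z1 - l * x1, z2 - l * x2,
    z3 - l * x3, h1, ?_, ?_, ?_, ?_, ?_⟩
  · linear_combination h2 - k * h1
  · linear_combination h3 - l * h1
  · linear_combination h4 - 2 * k * h2 + k ^ 2 * h1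
  · linear_combination h5 - k * h3 - l * h2 + k * l * h1
  · linear_combination h6 - 2 * l * h3 + l ^ 2 * h1

theorem IsGram.sl2 {a b c d e f : ℤ} (α β γ δ : ℤ) (hdet : α * δ - β * γ = 1)
    (h : IsGram a (α * b + γ * c) (β * b + δ * c) (α ^ 2 * d + 2 * α * γ * e + γ ^ 2 * f)
      (α * β * d + (α * δ + β * γ) * e + γ * δ * f) (β ^ 2 * d + 2 * β * δ * e + δ ^ 2 * f)) :
    IsGram a b c d e f := by
  obtain ⟨x1, x2, x3, y1, y2, y3, z1, z2, z3, h1, h2, h3, h4, h5, h6⟩ := h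
  refine ⟨x1, x2, x3, δ * y1 - γ * z1, δ * y2 - γ * z2, δ * y3 - γ * z3,
    α * z1 - β * y1, α * z2 - β * y2, α * z3 - β * y3, h1, ?_, ?_, ?_, ?_, ?_⟩
  · linear_combination δ * h2 - γ * h3 + b * hdet
  · linear_combination α * h3 - β * h2 + c * hdet
  · linear_combination δ ^ 2 * h4 - 2 * δ * γ * h5 + γ ^ 2 * h6
      + d * (α * δ - β * γ + 1) * hdet
  · linear_combination -δ * β * h4 + (α * δ + β * γ) * h5 - α * γ * h6
      + e * (α * δ - β * γ + 1) * hdet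
  · linear_combination β ^ 2 * h4 - 2 * α * β * h5 + α ^ 2 * h6
      + f * (α * δ - β * γ + 1) * hdet

theorem near_mul (b a : ℤ) (ha : 0 < a) : ∃ k : ℤ, 2 * (b + k * a) ≤ a ∧ -a ≤ 2 * (b + k * a) := by
  refine ⟨-((2 * b + a) / (2 * a)), ?_, ?_⟩
  · have := Int.lt_ediv_add_one_mul_self (2 * b + a) (show 0 < 2 * a by omega)
    nlinarith
  · have := Int.ediv_mul_le (2 * b + a) (show 2 * a ≠ 0 by omega)
    nlinarith

/-- A positive definite binary form of determinant one. -/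
theorem isGram_binary (d e f : ℤ) (hd : 0 < d) (h : d * f - e ^ 2 = 1) : IsGram 1 0 0 d e f := by
  obtain ⟨α, β, γ, δ, hdet, hpos, hle⟩ := binary_reduce _ d e f 1 le_rfl hd one_pos h
  refine IsGram.sl2 α β γ δ hdet ?_
  have hdet2 : (α ^ 2 * d + 2 * α * γ * e + γ ^ 2 * f) * (β ^ 2 * d + 2 * β * δ * e + δ ^ 2 * f)
      - (α * β * d + (α * δ + β * γ) * e + γ * δ * f) ^ 2 = 1 := by
    linear_combination (α * δ - β * γ) ^ 2 * h + (α * δ - β * γ + 1) * hdet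
  generalize α ^ 2 * d + 2 * α * γ * e + γ ^ 2 * f = d' at *
  generalize α * β * d + (α * δ + β * γ) * e + γ * δ * f = e' at *
  generalize β ^ 2 * d + 2 * β * δ * e + δ ^ 2 * f = f' at *
  have hd1 : d' = 1 := by nlinarith
  subst hd1
  refine ⟨1, 0, 0, 0, 1, 0, 0, e', 1, ?_, ?_, ?_, ?_, ?_, ?_⟩ <;> linarith

theorem isGram_ternary (N : ℕ) : ∀ a b c d e f : ℤ, a.toNat ≤ N → 0 < a → 0 < a * d - b ^ 2 →
    (a * d - b ^ 2) * (a * f - c ^ 2) - (a * e - b * c) ^ 2 = a → IsGram a b c d e f := by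
  induction N with
  | zero => intro a b c d e f h hp; omega
  | succ N ih =>
    intro a b c d e f hN ha hp h
    obtain ⟨α, β, γ, δ, hdet, hpos, hle⟩ := binary_reduce _ _ _ _ a le_rfl hp ha h
    refine IsGram.sl2 α β γ δ hdet ?_
    have e1 : α ^ 2 * (a * d - b ^ 2) + 2 * α * γ * (a * e - b * c) + γ ^ 2 * (a * f - c ^ 2)
      = a * (α ^ 2 * d + 2 * α * γ * e + γ ^ 2 * f) - (α * b + γ * c) ^ 2 := by ring
    have hdet2 : (a * (α ^ 2 * d + 2 * α * γ * e + γ ^ 2 * f) - (α * b + γ * c) ^ 2) *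
        (a * (β ^ 2 * d + 2 * β * δ * e + δ ^ 2 * f) - (β * b + δ * c) ^ 2)
        - (a * (α * β * d + (α * δ + β * γ) * e + γ * δ * f)
          - (α * b + γ * c) * (β * b + δ * c)) ^ 2 = a := by
      linear_combination (α * δ - β * γ) ^ 2 * h + a * (α * δ - β * γ + 1) * hdet
    rw [e1] at hpos hle
    generalize α ^ 2 * d + 2 * α * γ * e + γ ^ 2 * f = d' at *
    generalize α * β * d + (α * δ + β * γ) * e + γ * δ * f = e' at *
    generalize β ^ 2 * d + 2 * β * δ * e + δ ^ 2 * f = f' at *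
    generalize α * b + γ * c = b' at *
    generalize β * b + δ * c = c' at *
    clear e1 h hp hdet
    obtain ⟨k, hk1, hk2⟩ := near_mul b' a ha
    refine IsGram.trans k 0 ?_
    have e2 : a * d' - b' ^ 2 = a * (d' + 2 * k * b' + k ^ 2 * a) - (b' + k * a) ^ 2 := by ring
    have e3 : a * e' - b' * c' = a * (e' + k * c' + 0 * b' + k * 0 * a)
      - (b' + k * a) * (c' + 0 * a) := by ring
    have e4 : a * f' - c' ^ 2 = a * (f' + 2 * 0 * c' + 0 ^ 2 * a) - (c' + 0 * a) ^ 2 := by ring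
    rw [e2] at hpos hle
    rw [e2, e3, e4] at hdet2
    generalize d' + 2 * k * b' + k ^ 2 * a = d at *
    generalize b' + k * a = b at *
    generalize e' + k * c' + 0 * b' + k * 0 * a = e at *
    generalize f' + 2 * 0 * c' + 0 ^ 2 * a = f at *
    generalize c' + 0 * a = c at *
    clear e2 e3 e4
    have hb : 4 * b ^ 2 ≤ a ^ 2 := by nlinarith
    have hd0 : 0 < d := by
      by_contra hcon
      nlinarith [sq_nonneg b]
    by_cases hlt : d < a
    · apply IsGram.swap
      refine ih d b e a c f (by omega) hd0 (by linarith) ?_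
      have h0 : a * (a * d * f + 2 * b * c * e - a * e ^ 2 - d * c ^ 2 - f * b ^ 2 - 1) = 0 := by
        linear_combination hdet2
      have h1 := (mul_eq_zero.mp h0).resolve_left ha.ne'
      linear_combination d * h1
    · have ha1 : a = 1 := by
        by_contra hne
        have ha2 : 2 ≤ a := by omega
        have h1 : 3 * a ^ 2 ≤ 4 * (a * d - b ^ 2) := by nlinarith
        have h2 : 9 * (a ^ 2) ^ 2 ≤ 16 * (a * d - b ^ 2) ^ 2 := by nlinarith
        have h3 : 27 * a ^ 4 ≤ 64 * a := by nlinarith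
        have h4 : 8 ≤ a ^ 3 := by nlinarith [pow_le_pow_left₀ (by norm_num) ha2 3]
        nlinarith
      subst ha1
      refine IsGram.trans (-b) (-c) ?_
      have := isGram_binary (d + 2 * (-b) * b + (-b) ^ 2 * 1) (e + (-b) * c + (-c) * b + (-b) * (-c) * 1)
        (f + 2 * (-c) * c + (-c) ^ 2 * 1) (by linarith) (by linear_combination hdet2)
      convert this using 1 <;> ring

theorem three_sq_aux (m p j : ℕ) (hm : m % 4 = 1) (hp : p.Prime)
    (h : 2 * p + 1 = (8 * j + 3) * m) : ∃ x y z : ℤ, x * x + y * y + z * z = m := by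
  have : Fact p.Prime := ⟨hp⟩
  set b := 8 * j + 3 with hb
  have hmod : (2 * p + 1) % 8 = (3 * (m % 8)) % 8 := by
    rw [h, hb, Nat.mul_mod, Nat.mul_add_mod]
  have hpodd : p % 2 = 1 := by omega
  have hpo : Odd p := Nat.odd_iff.mpr hpodd
  have hbo : Odd b := Nat.odd_iff.mpr (by omega)
  have hpb : jacobiSym p b = 1 := by
    have h1 : jacobiSym (-2) b = 1 := by
      rw [jacobiSym.at_neg_two hbo, ZMod.χ₈'_nat_eq_if_mod_eight]
      rw [if_neg (by omega), if_pos (by omega)]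
    have h2 : jacobiSym (-2 * p) b = 1 := by
      have : (-2 * p : ℤ) = 1 + b * (-m) := by
        have : (2 * p + 1 : ℤ) = b * m := by exact_mod_cast h
        linarith
      rw [this, jacobiSym.mod_left, Int.add_mul_emod_self_left, ← jacobiSym.mod_left,
        jacobiSym.one_left]
    rwa [jacobiSym.mul_left, h1, one_mul] at h2
  have hneg : jacobiSym (-b) p = 1 := by
    rw [jacobiSym.neg _ hpo]
    rcases (by omega : p % 4 = 1 ∨ p % 4 = 3) with h4 | h4
    · rw [ZMod.χ₄_nat_one_mod_four h4, ← jacobiSym.quadratic_reciprocity_one_mod_four h4 hbo, hpb]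
      rfl
    · rw [ZMod.χ₄_nat_three_mod_four h4,
        jacobiSym.quadratic_reciprocity_three_mod_four (by omega) h4, hpb]
      rfl
  have hsq := ZMod.isSquare_of_jacobiSym_eq_one hneg
  obtain ⟨t, ht⟩ := hsq
  obtain ⟨t0, rfl⟩ := ZMod.intCast_surjective t
  have hdvd : (p : ℤ) ∣ t0 * t0 + b := by
    rw [← ZMod.intCast_zmod_eq_zero_iff_dvd]
    push_cast
    rw [← ht]; push_cast; ring
  obtain ⟨t, htodd, htd⟩ : ∃ t : ℤ, t % 2 = 1 ∧ (p : ℤ) ∣ t * t + b := by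
    rcases Int.emod_two_eq_zero_or_one t0 with h0 | h0
    · refine ⟨t0 + p, by omega, ?_⟩
      have : (t0 + p) * (t0 + p) + b = (t0 * t0 + b) + p * (2 * t0 + p) := by ring
      rw [this]; exact dvd_add hdvd (dvd_mul_right _ _)
    · exact ⟨t0, h0, hdvd⟩
  have h2d : (2 : ℤ) ∣ t * t + b := by
    have : (t * t) % 2 = 1 := by simp [Int.mul_emod, htodd]
    omega
  have h2p : (2 * p : ℤ) ∣ t * t + b := by
    refine IsCoprime.mul_dvd ?_ h2d htd
    rw [Int.isCoprime_iff_gcd_eq_one]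
    have := (Nat.coprime_two_left (n := p)).mpr hpo
    simpa [Int.gcd] using this
  obtain ⟨a, ha⟩ := h2p
  have hp0 : (0 : ℤ) < p := by exact_mod_cast hp.pos
  have hb0 : (0 : ℤ) < b := by rw [hb]; positivity
  have ha0 : 0 < a := by
    by_contra hcon
    nlinarith [mul_self_nonneg t]
  have hz : (2 * p + 1 : ℤ) = b * m := by exact_mod_cast h
  have hg : IsGram a t 1 (2 * p) 0 m := by
    refine isGram_ternary _ a t 1 (2 * p) 0 m le_rfl ha0 (by linarith) ?_
    linear_combination (-m * a) * ha - a * hz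
  obtain ⟨_, _, _, _, _, _, z1, z2, z3, _, _, _, _, _, h6⟩ := hg
  exact ⟨z1, z2, z3, h6⟩

theorem three_sq (m : ℕ) (hm : m % 4 = 1) : ∃ x y z : ℤ, x * x + y * y + z * z = m := by
  have hco : ((3 * m - 1) / 2).Coprime (4 * m) := by
    have h1 : 2 * ((3 * m - 1) / 2) + 1 = 3 * m := by omega
    have h2 : ((3 * m - 1) / 2) % 2 = 1 := by omega
    generalize (3 * m - 1) / 2 = u at *
    refine Nat.Coprime.mul_right ?_ ?_
    · have : Nat.Coprime u 2 := (Nat.coprime_two_right (n := u)).mpr (Nat.odd_iff.mpr h2)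
      exact Nat.Coprime.mul_right this this
    · refine Nat.Coprime.of_dvd_left (dvd_mul_left u 2) ?_
      have h3 : Nat.Coprime (2 * u) (2 * u + 1) := by simp
      rw [h1] at h3
      exact Nat.Coprime.of_dvd_right (dvd_mul_left m 3) h3
  obtain ⟨p, hgt, hp, hmod⟩ := Nat.forall_exists_prime_gt_and_modEq ((3 * m - 1) / 2)
    (show 4 * m ≠ 0 by omega) hco
  obtain ⟨j, hj⟩ := (Nat.modEq_iff_dvd' hgt.le).mp hmod.symm
  refine three_sq_aux m p j hm hp ?_
  have h1 : 2 * ((3 * m - 1) / 2) + 1 = 3 * m := by omega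
  have h2 : p = 4 * m * j + (3 * m - 1) / 2 := by omega
  rw [h2]
  linarith

theorem diag_form (x y z : ℤ) (hxy : (x - y) % 2 = 0) (h3 : (x + y + z) % 3 = 0) :
    ∃ u v w : ℤ, 2 * u ^ 2 + 3 * v ^ 2 + 6 * w ^ 2 = x * x + y * y + z * z := by
  obtain ⟨u, hu⟩ : ∃ u, x - y = 2 * u := ⟨(x - y) / 2, by omega⟩
  obtain ⟨v, hv⟩ : ∃ v, x + y + z = 3 * v := ⟨(x + y + z) / 3, by omega⟩
  obtain ⟨w, hw⟩ : ∃ w, x + y - 2 * z = 6 * w := ⟨(x + y - 2 * z) / 6, by omega⟩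
  refine ⟨u, v, w, ?_⟩
  have hx : x = v + u + w := by omega
  have hy : y = v - u + w := by omega
  have hz : z = v - 2 * w := by omega
  rw [hx, hy, hz]; ring

theorem diag_form' (x y z : ℤ) (hxy : (x - y) % 2 = 0) (h3 : (x * x + y * y + z * z) % 3 ≠ 1) :
    ∃ u v w : ℤ, 2 * u ^ 2 + 3 * v ^ 2 + 6 * w ^ 2 = x * x + y * y + z * z := by
  have key : (x + y + z) % 3 = 0 ∨ (x + y + -z) % 3 = 0 ∨ (x + -y + z) % 3 = 0 ∨
      (x + -y + -z) % 3 = 0 := by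
    have e : (x * x + y * y + z * z) % 3 =
        ((x % 3) * (x % 3) + (y % 3) * (y % 3) + (z % 3) * (z % 3)) % 3 := by
      simp [Int.add_emod, Int.mul_emod]
    rw [e] at h3
    rcases (by omega : x % 3 = 0 ∨ x % 3 = 1 ∨ x % 3 = 2) with hx | hx | hx <;>
    rcases (by omega : y % 3 = 0 ∨ y % 3 = 1 ∨ y % 3 = 2) with hy | hy | hy <;>
    rcases (by omega : z % 3 = 0 ∨ z % 3 = 1 ∨ z % 3 = 2) with hz | hz | hz <;>
    rw [hx, hy, hz] at h3 <;> omega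
  rcases key with h | h | h | h
  · exact diag_form x y z hxy h
  · simpa using diag_form x y (-z) hxy h
  · simpa using diag_form x (-y) z (by omega) h
  · simpa using diag_form x (-y) (-z) (by omega) h

theorem diag_form'' (x y z : ℤ) (h3 : (x * x + y * y + z * z) % 3 ≠ 1) :
    ∃ u v w : ℤ, 2 * u ^ 2 + 3 * v ^ 2 + 6 * w ^ 2 = x * x + y * y + z * z := by
  rcases (by omega : (x - y) % 2 = 0 ∨ (y - z) % 2 = 0 ∨ (x - z) % 2 = 0) with h | h | h
  · exact diag_form' x y z h h3
  · have e : x * x + y * y + z * z = y * y + z * z + x * x := by ring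
    rw [e] at h3 ⊢
    exact diag_form' y z x h h3
  · have e : x * x + y * y + z * z = x * x + z * z + y * y := by ring
    rw [e] at h3 ⊢
    exact diag_form' x z y h h3

theorem cauchy_int (a b x y z : ℤ) (hab : (a - b) % 2 = 0)
    (h : 6 * a - b ^ 2 = x * x + y * y + z * z) :
    ∃ x1 x2 x3 x4 : ℤ, x1 ^ 2 + x2 ^ 2 + 2 * x3 ^ 2 + 2 * x4 ^ 2 = a ∧
      x1 + x2 + 2 * x3 + 2 * x4 = b := by
  have hb3 : b ^ 2 % 3 = 0 ∧ b % 3 = 0 ∨ b ^ 2 % 3 = 1 ∧ b % 3 ≠ 0 := by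
    rcases (by omega : b % 3 = 0 ∨ b % 3 = 1 ∨ b % 3 = 2) with hx | hx | hx <;>
    simp [pow_two, Int.mul_emod, hx]
  obtain ⟨u0, v, w, huvw⟩ := diag_form'' x y z (by rw [← h]; omega)
  rw [← h] at huvw
  have hu3 : u0 ^ 2 % 3 = 0 ∧ u0 % 3 = 0 ∨ u0 ^ 2 % 3 = 1 ∧ u0 % 3 ≠ 0 := by
    rcases (by omega : u0 % 3 = 0 ∨ u0 % 3 = 1 ∨ u0 % 3 = 2) with hx | hx | hx <;>
    simp [pow_two, Int.mul_emod, hx]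
  obtain ⟨u, hu, hub⟩ : ∃ u : ℤ, u ^ 2 = u0 ^ 2 ∧ (u + b) % 3 = 0 := by
    have hor : (u0 + b) % 3 = 0 ∨ (-u0 + b) % 3 = 0 := by
      rcases (by omega : b % 3 = 0 ∨ b % 3 = 1 ∨ b % 3 = 2) with hx | hx | hx <;>
      rcases (by omega : u0 % 3 = 0 ∨ u0 % 3 = 1 ∨ u0 % 3 = 2) with hy | hy | hy <;> omega
    rcases hor with h | h
    · exact ⟨u0, rfl, h⟩
    · exact ⟨-u0, by ring, h⟩
  rw [← hu] at huvw
  clear hu hu3 hb3 h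
  obtain ⟨t, ht⟩ : ∃ t, u + b = 3 * t := ⟨(u + b) / 3, by omega⟩
  have sq4 : ∀ r : ℤ, r ^ 2 % 4 = 0 ∧ r % 2 = 0 ∨ r ^ 2 % 4 = 1 ∧ r % 2 = 1 := by
    intro r
    rcases (by omega : r % 4 = 0 ∨ r % 4 = 1 ∨ r % 4 = 2 ∨ r % 4 = 3) with hx | hx | hx | hx <;>
    simp [pow_two, Int.mul_emod, hx] <;> omega
  have sq8 : ∀ r : ℤ, r % 2 = 1 → r ^ 2 % 8 = 1 := by
    intro r hr
    rcases (by omega : r % 8 = 1 ∨ r % 8 = 3 ∨ r % 8 = 5 ∨ r % 8 = 7) with hx | hx | hx | hx <;>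
    simp [pow_two, Int.mul_emod, hx]
  have hub := sq4 u
  have hvb := sq4 v
  have hwb := sq4 w
  have hbb := sq4 b
  have hb8 := sq8 b
  have hv8 := sq8 v
  have hvpar : (v - b) % 2 = 0 := by omega
  have hwpar : (w - t) % 2 = 0 := by
    rcases hbb with hbb | hbb <;> omega
  obtain ⟨x1, hx1⟩ : ∃ x1, b - 2 * t + v = 2 * x1 := ⟨(b - 2 * t + v) / 2, by omega⟩
  obtain ⟨x3, hx3⟩ : ∃ x3, t + w = 2 * x3 := ⟨(t + w) / 2, by omega⟩
  refine ⟨x1, x1 - v, x3, x3 - w, ?_, by omega⟩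
  have e1 : t = 2 * x3 - w := by omega
  have e2 : b = 2 * x1 - v + 2 * t := by omega
  have e3 : u = 3 * t - b := by omega
  rw [e3, e2, e1] at huvw
  linarith

theorem cauchy_nat (a b x y z : ℤ) (hab : (a - b) % 2 = 0) (hb : 0 ≤ b)
    (hlt : 5 * a < b ^ 2 + 2 * b + 6)
    (h : 6 * a - b ^ 2 = x * x + y * y + z * z) :
    ∃ x1 x2 x3 x4 : ℕ, (x1 : ℤ) ^ 2 + x2 ^ 2 + 2 * x3 ^ 2 + 2 * x4 ^ 2 = a ∧
      (x1 : ℤ) + x2 + 2 * x3 + 2 * x4 = b := by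
  obtain ⟨x1, x2, x3, x4, h1, h2⟩ := cauchy_int a b x y z hab h
  have one : ∀ p q r s : ℤ, p ^ 2 + q ^ 2 + 2 * r ^ 2 + 2 * s ^ 2 = a →
      p + q + 2 * r + 2 * s = b → 0 ≤ p := by
    intro p q r s e1 e2
    by_contra hcon
    have h5 : (b - p) ^ 2 ≤ 5 * (a - p ^ 2) := by
      rw [← e1, ← e2]
      nlinarith [sq_nonneg (q - r), sq_nonneg (q - s), sq_nonneg (r - s)]
    nlinarith
  have two : ∀ p q r s : ℤ, p ^ 2 + q ^ 2 + 2 * r ^ 2 + 2 * s ^ 2 = a →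
      p + q + 2 * r + 2 * s = b → 0 ≤ r := by
    intro p q r s e1 e2
    by_contra hcon
    have h5 : (b - 2 * r) ^ 2 ≤ 4 * (a - 2 * r ^ 2) := by
      rw [← e1, ← e2]
      nlinarith [sq_nonneg (p - q), sq_nonneg (p - s), sq_nonneg (q - s)]
    nlinarith
  have p1 := one x1 x2 x3 x4 h1 h2
  have p2 := one x2 x1 x3 x4 (by linarith) (by linarith)
  have p3 := two x1 x2 x3 x4 h1 h2
  have p4 := two x1 x2 x4 x3 (by linarith) (by linarith)
  lift x1 to ℕ using p1
  lift x2 to ℕ using p2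
  lift x3 to ℕ using p3
  lift x4 to ℕ using p4
  exact ⟨x1, x2, x3, x4, h1, h2⟩

/-- Hexagonal numbers. -/
def hexNum (x : ℕ) : ℕ := x * (2 * x - 1)

theorem hexNum_cast (x : ℕ) : (hexNum x : ℤ) = 2 * (x : ℤ) ^ 2 - x := by
  unfold hexNum
  rcases Nat.eq_zero_or_pos x with rfl | h
  · simp
  · rw [Nat.cast_mul, Nat.cast_sub (by omega)]; push_cast; ring

theorem of_cauchy (n : ℕ) (a b x y z : ℤ) (hn : (n : ℤ) = 2 * a - b) (hab : (a - b) % 2 = 0)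
    (hb : 0 ≤ b) (hlt : 5 * a < b ^ 2 + 2 * b + 6)
    (h : 6 * a - b ^ 2 = x * x + y * y + z * z) :
    ∃ x1 x2 x3 x4 : ℕ, n = hexNum x1 + hexNum x2 + 2 * hexNum x3 + 2 * hexNum x4 := by
  obtain ⟨x1, x2, x3, x4, h1, h2⟩ := cauchy_nat a b x y z hab hb hlt h
  refine ⟨x1, x2, x3, x4, ?_⟩
  zify
  simp only [hexNum_cast]
  linarith

theorem large_case_s7 (n : ℕ) (hn : 11000 ≤ n) :
    ∃ x1 x2 x3 x4 : ℕ, n = hexNum x1 + hexNum x2 + 2 * hexNum x3 + 2 * hexNum x4 := by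
  obtain ⟨s, hs1, hs2⟩ : ∃ s : ℤ, 165 ≤ s ∧ (2 * s ^ 2 ≤ 5 * n ∧ 5 * n < 2 * (s + 1) ^ 2) := by
    refine ⟨(Nat.sqrt (5 * n / 2) : ℕ), ?_, ?_, ?_⟩
    · have : 165 ≤ Nat.sqrt (5 * n / 2) := by
        rw [Nat.le_sqrt]; omega
      exact_mod_cast this
    · have := Nat.sqrt_le' (5 * n / 2)
      have : 2 * Nat.sqrt (5 * n / 2) ^ 2 ≤ 5 * n := by omega
      exact_mod_cast this
    · have := Nat.lt_succ_sqrt' (5 * n / 2)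
      rw [Nat.succ_eq_add_one] at this
      have : 5 * n < 2 * (Nat.sqrt (5 * n / 2) + 1) ^ 2 := by omega
      exact_mod_cast this
  have bounds : ∀ a b : ℤ, s + 2 ≤ b → b ≤ s + 17 → (n : ℤ) = 2 * a - b →
      5 * a < b ^ 2 + 2 * b + 6 ∧ 0 < 6 * a - b ^ 2 := by
    intro a b h1 h2 h3
    constructor <;> nlinarith
  have choice : ∀ r : ℤ, ∃ b : ℤ, s + 2 ≤ b ∧ b ≤ s + 17 ∧ (b - r) % 16 = 0 := by
    intro r
    exact ⟨s + 2 + (r - (s + 2)) % 16, by omega, by omega, by omega⟩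
  rcases (by omega : n % 2 = 1 ∨ n % 4 = 0 ∨ n % 4 = 2) with hpar | hpar | hpar
  · obtain ⟨b, hb1, hb2, hb3⟩ := choice (2 - n)
    obtain ⟨a, ha⟩ : ∃ a : ℤ, (n : ℤ) = 2 * a - b := ⟨(n + b) / 2, by omega⟩
    obtain ⟨hlt, hpos⟩ := bounds a b hb1 hb2 ha
    have hbsq : b ^ 2 % 4 = 1 := by
      rcases (by omega : b % 4 = 1 ∨ b % 4 = 3) with hx | hx <;>
      simp [pow_two, Int.mul_emod, hx]
    obtain ⟨x, y, z, hxyz⟩ := three_sq (6 * a - b ^ 2).toNat (by omega)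
    rw [Int.toNat_of_nonneg hpos.le] at hxyz
    exact of_cauchy n a b x y z ha (by omega) (by omega) hlt hxyz.symm
  · obtain ⟨b, hb1, hb2, hb3⟩ := choice (12 - n)
    obtain ⟨a, ha⟩ : ∃ a : ℤ, (n : ℤ) = 2 * (2 * a) - b := ⟨(n + b) / 4, by omega⟩
    obtain ⟨hlt, hpos⟩ := bounds (2 * a) b hb1 hb2 ha
    obtain ⟨c, rfl⟩ : ∃ c, b = 2 * (2 * c) := ⟨b / 4, by omega⟩
    obtain ⟨x, y, z, hxyz⟩ := three_sq (3 * a - 4 * c ^ 2).toNat (by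
      have : 0 < 3 * a - 4 * c ^ 2 := by linarith
      omega)
    rw [Int.toNat_of_nonneg (by linarith)] at hxyz
    exact of_cauchy n (2 * a) (2 * (2 * c)) (2 * x) (2 * y) (2 * z) ha (by omega) (by omega) hlt
      (by linarith)
  · obtain ⟨b, hb1, hb2, hb3⟩ := choice (8 - n)
    obtain ⟨a, ha⟩ : ∃ a : ℤ, (n : ℤ) = 2 * (2 * a) - b := ⟨(n + b) / 4, by omega⟩
    obtain ⟨hlt, hpos⟩ := bounds (2 * a) b hb1 hb2 ha
    obtain ⟨c, rfl⟩ : ∃ c, b = 2 * c := ⟨b / 2, by omega⟩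
    have hcsq : c ^ 2 % 4 = 1 := by
      rcases (by omega : c % 4 = 1 ∨ c % 4 = 3) with hx | hx <;>
      simp [pow_two, Int.mul_emod, hx]
    obtain ⟨x, y, z, hxyz⟩ := three_sq (3 * a - c ^ 2).toNat (by
      have : 0 < 3 * a - c ^ 2 := by linarith
      omega)
    rw [Int.toNat_of_nonneg (by linarith)] at hxyz
    exact of_cauchy n (2 * a) (2 * c) (2 * x) (2 * y) (2 * z) ha (by omega) (by omega) hlt
      (by linarith)

/-- Bit set of the sums `c * hexNum k + s` with `k < K` and `s` in the bit set `S`. -/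
def shiftOr (c S : ℕ) : ℕ → ℕ
  | 0 => 0
  | k + 1 => shiftOr c S k ||| (S <<< (c * (k * (2 * k - 1))))

theorem shiftOr_spec (c S K n : ℕ) (h : (shiftOr c S K).testBit n = true) :
    ∃ k r, n = c * hexNum k + r ∧ S.testBit r = true := by
  induction K with
  | zero => simp [shiftOr] at h
  | succ K ih =>
    rw [shiftOr, Nat.testBit_or, Bool.or_eq_true] at h
    rcases h with h | h
    · exact ih h
    · rw [Nat.testBit_shiftLeft] at h
      simp only [Bool.and_eq_true, decide_eq_true_eq] at h
      exact ⟨K, n - c * hexNum K, by have := h.1; unfold hexNum; omega, h.2⟩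

set_option exponentiation.threshold 20000 in
theorem bits_check :
    (shiftOr 2 (shiftOr 2 (shiftOr 1 (shiftOr 1 1 75) 75) 53) 53 ||| (2 ^ 22 ||| (2 ^ 82 ||| 2 ^ 100)))
      % 2 ^ 11000 = 2 ^ 11000 - 1 := by
  decide +kernel

theorem small_case_s7 (n : ℕ) (hn : n < 11000) (h1 : n ≠ 22) (h2 : n ≠ 82) (h3 : n ≠ 100) :
    ∃ x1 x2 x3 x4 : ℕ, n = hexNum x1 + hexNum x2 + 2 * hexNum x3 + 2 * hexNum x4 := by
  have h := congrArg (fun t => Nat.testBit t n) bits_check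
  simp only [Nat.testBit_mod_two_pow, Nat.testBit_two_pow_sub_one, Nat.testBit_or,
    Nat.testBit_two_pow, hn, h1.symm, h2.symm, h3.symm, decide_true, decide_false, Bool.true_and,
    Bool.or_false] at h
  obtain ⟨x4, r4, e4, h⟩ := shiftOr_spec _ _ _ _ h
  obtain ⟨x3, r3, e3, h⟩ := shiftOr_spec _ _ _ _ h
  obtain ⟨x2, r2, e2, h⟩ := shiftOr_spec _ _ _ _ h
  obtain ⟨x1, r1, e1, h⟩ := shiftOr_spec _ _ _ _ h
  have hr : r1 = 0 := by
    by_contra hne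
    have := Nat.testBit_two_pow (n := 0) (m := r1)
    simp only [pow_zero] at this
    rw [this] at h
    simp at h
    omega
  exact ⟨x1, x2, x3, x4, by omega⟩

theorem exceptions_check : ∀ a b c d : Fin 8,
    hexNum a + hexNum b + 2 * hexNum c + 2 * hexNum d ≠ 22 ∧
    hexNum a + hexNum b + 2 * hexNum c + 2 * hexNum d ≠ 82 ∧
    hexNum a + hexNum b + 2 * hexNum c + 2 * hexNum d ≠ 100 := by
  decide +kernel

theorem hexNum_lt (x : ℕ) (h : hexNum x ≤ 100) : x < 8 := by
  have e := hexNum_cast x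
  by_contra hcon
  have : (8 : ℤ) ≤ x := by omega
  have h' : (hexNum x : ℤ) ≤ 100 := by exact_mod_cast h
  nlinarith

theorem sum_hexagonal_1122_range :
    {n : ℕ | ∃ x₁ x₂ x₃ x₄ : ℕ,
        n = x₁ * (2 * x₁ - 1) + x₂ * (2 * x₂ - 1)
            + 2 * (x₃ * (2 * x₃ - 1)) + 2 * (x₄ * (2 * x₄ - 1))}
      = {n : ℕ | n ∉ ({22, 82, 100} : Set ℕ)} := by
  ext n
  simp only [Set.mem_ofPred_eq, Set.mem_insert_iff, Set.mem_singleton_iff, not_or]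
  change (∃ x₁ x₂ x₃ x₄ : ℕ, n = hexNum x₁ + hexNum x₂ + 2 * hexNum x₃ + 2 * hexNum x₄) ↔ _
  constructor
  · rintro ⟨a, b, c, d, h⟩
    by_cases hn : n ≤ 100
    · have := exceptions_check ⟨a, hexNum_lt a (by omega)⟩ ⟨b, hexNum_lt b (by omega)⟩
        ⟨c, hexNum_lt c (by omega)⟩ ⟨d, hexNum_lt d (by omega)⟩
      simp only [← h] at this
      exact this
    · omega
  · rintro ⟨h1, h2, h3⟩
    by_cases hn : n < 11000
    · exact small_case_s7 n hn h1 h2 h3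
    · exact large_case_s7 n (by omega)
end
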